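/- arXiv:1908.00869 — 3 statements merged into one kernel-verified Lean document; each statement's English description precedes it below -/
import Mathlib

section
/- The set {a ∈ ℝ : H = a admits a subsolution} is nonempty and bounded from below, and its infimum c (the critical value) belongs to the set; that is, the infimum is attained and H = c admits a subsolution. -/
open MeasureTheory Set
open scoped RealInnerProductSpace

noncomputable section

abbrev Euc (N : ℕ) := EuclideanSpace ℝ (Fin N)

/-- `u` is an (a.e.) subsolution of `H = a` in `ℝ^N`. -/
def IsSubsol {N : ℕ} (H : Euc N × Euc N → ℝ) (a : ℝ) (u : Euc N → ℝ) : Prop :=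
  LocallyLipschitz u ∧
    ∀ᵐ x : Euc N ∂volume, DifferentiableAt ℝ u x → H (x, gradient u x) ≤ a

/-- `u` is an (a.e.) subsolution of the discounted equation `λ u + H(x,Du) = 0`. -/
def IsDiscSubsol {N : ℕ} (H : Euc N × Euc N → ℝ) (lam : ℝ) (u : Euc N → ℝ) : Prop :=
  LocallyLipschitz u ∧
    ∀ᵐ x : Euc N ∂volume, DifferentiableAt ℝ u x →
      lam * u x + H (x, gradient u x) ≤ 0

/-- The Lagrangian associated with `H` via the Fenchel transform. -/
def Lag {N : ℕ} (H : Euc N × Euc N → ℝ) : Euc N × Euc N → ℝ :=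
  fun z => sSup (Set.range fun p : Euc N => ⟪p, z.2⟫ - H (z.1, p))

/-- `u` is a subsolution for the generalized Lagrangian `Φ`. -/
def SubsolFor {N : ℕ} (Φ : Euc N × Euc N → ℝ) (u : Euc N → ℝ) : Prop :=
  LocallyLipschitz u ∧
    ∀ᵐ x : Euc N ∂volume, DifferentiableAt ℝ u x →
      ∀ q : Euc N, fderiv ℝ u x q ≤ Φ (x, q)

/-- `u` is a `λ`-discounted subsolution for the generalized Lagrangian `Φ`. -/
def DiscSubsolFor {N : ℕ} (lam : ℝ) (Φ : Euc N × Euc N → ℝ) (u : Euc N → ℝ) : Prop :=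
  LocallyLipschitz u ∧
    ∀ᵐ x : Euc N ∂volume, DifferentiableAt ℝ u x →
      ∀ q : Euc N, lam * u x + fderiv ℝ u x q ≤ Φ (x, q)

/-- A Mather measure for the ergodic problem. -/
def MatherMeasure {N : ℕ} (H : Euc N × Euc N → ℝ) (μ : Measure (Euc N × Euc N)) : Prop :=
  IsProbabilityMeasure μ ∧ Integrable (Lag H) μ ∧ (∫ z, Lag H z ∂μ) = 0 ∧
    ∀ Φ : Euc N × Euc N → ℝ, Continuous Φ → BddBelow (Set.range Φ) →
      (∃ u, SubsolFor Φ u) → (Integrable Φ μ → 0 ≤ ∫ z, Φ z ∂μ)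

/-- A `(λ,z)`-Mather measure (relative to the maximal discounted solution `um`). -/
def DiscMatherMeasure {N : ℕ} (H : Euc N × Euc N → ℝ) (lam : ℝ) (z : Euc N)
    (um : Euc N → ℝ) (μ : Measure (Euc N × Euc N)) : Prop :=
  IsProbabilityMeasure μ ∧ Integrable (Lag H) μ ∧ (∫ w, Lag H w ∂μ) = lam * um z ∧
    ∀ Φ : Euc N × Euc N → ℝ, Continuous Φ → BddBelow (Set.range Φ) →
      ∀ u : Euc N → ℝ, DiscSubsolFor lam Φ u →
        (Integrable Φ μ → lam * u z ≤ ∫ w, Φ w ∂μ)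

open Filter Topology

/-- Rademacher's theorem for locally Lipschitz functions. -/
theorem LocallyLipschitz.ae_differentiableAt_euc {N : ℕ} {w : Euc N → ℝ}
    (hw : LocallyLipschitz w) : ∀ᵐ x : Euc N ∂volume, DifferentiableAt ℝ w x := by
  have h (n : ℕ) : ∀ᵐ x : Euc N ∂volume, x ∈ Metric.ball (0 : Euc N) n →
      DifferentiableAt ℝ w x := by
    obtain ⟨K, hK⟩ := LocallyLipschitzOn.exists_lipschitzOnWith_of_compact
      (isCompact_closedBall (0 : Euc N) n) hw.locallyLipschitzOn
    filter_upwards [(hK.mono Metric.ball_subset_closedBall).ae_differentiableWithinAt_of_mem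
      (μ := (volume : Measure (Euc N)))] with x hx hxn
    exact (hx hxn).differentiableAt (Metric.isOpen_ball.mem_nhds hxn)
  filter_upwards [ae_all_iff.2 h] with x hx
  obtain ⟨n, hn⟩ := exists_nat_gt ‖x‖
  exact hx n (by simpa using hn)

/-- An a.e. bound on the directional derivative of a locally Lipschitz function on a convex open
set integrates to a bound on its increments. -/
theorem LocallyLipschitz.sub_le_of_ae_fderiv_le {N : ℕ} {w : Euc N → ℝ}
    (hw : LocallyLipschitz w) {U : Set (Euc N)} (hUo : IsOpen U) (hUc : Convex ℝ U)
    {v : Euc N} {α : ℝ} (h : ∀ᵐ x : Euc N ∂volume, x ∈ U → fderiv ℝ w x v ≤ α)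
    {x : Euc N} (hx : x ∈ U) (hxv : x + v ∈ U) : w (x + v) - w x ≤ α := by
  have hline : ∀ᵐ y : Euc N ∂volume, ∀ᵐ t : ℝ ∂volume,
      DifferentiableAt ℝ w (y + t • v) ∧ (y + t • v ∈ U → fderiv ℝ w (y + t • v) v ≤ α) := by
    have hgood := hw.ae_differentiableAt_euc.and h
    set s : Set (Euc N) := (toMeasurable volume
      {y | DifferentiableAt ℝ w y ∧ (y ∈ U → fderiv ℝ w y v ≤ α)}ᶜ)ᶜ with hs
    have hsm : MeasurableSet s := (measurableSet_toMeasurable _ _).compl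
    have hsae : ∀ᵐ y : Euc N ∂volume, y ∈ s := by
      rw [ae_iff]
      simp only [hs, mem_compl_iff, not_not, ofPred_mem_eq, measure_toMeasurable]
      exact hgood
    have := (ae_ae_add_linearMap_mem_iff (LinearMap.toSpanSingleton ℝ (Euc N) v)
      (volume : Measure ℝ) (volume : Measure (Euc N)) hsm).2 hsae
    filter_upwards [this] with y hy
    filter_upwards [hy] with t ht
    by_contra hcon
    exact ht (subset_toMeasurable _ _ hcon)
  have hinc : ∀ᵐ y : Euc N ∂volume, y ∈ U → y + v ∈ U → w (y + v) - w y ≤ α := by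
    filter_upwards [hline] with y hy hyU hyvU
    have hL : LocallyLipschitz (fun t : ℝ => w (y + t • v)) := by
      refine hw.comp (g := fun t : ℝ => y + t • v) ?_
      exact ContDiff.locallyLipschitz (𝕂 := ℝ) (by fun_prop)
    obtain ⟨K, hK⟩ := LocallyLipschitzOn.exists_lipschitzOnWith_of_compact
      (isCompact_uIcc (a := (0 : ℝ)) (b := 1)) hL.locallyLipschitzOn
    have hac := hK.absolutelyContinuousOnInterval
    have hftc := hac.integral_deriv_eq_sub
    have hle : ∫ t in (0 : ℝ)..1, deriv (fun t : ℝ => w (y + t • v)) t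
        ≤ ∫ _ in (0 : ℝ)..1, α := by
      refine intervalIntegral.integral_mono_ae_restrict zero_le_one
        hac.intervalIntegrable_deriv (by simp) ?_
      refine (ae_restrict_iff' measurableSet_Icc).2 ?_
      filter_upwards [hy] with t ht htI
      have hmem : y + t • v ∈ U := by
        have := hUc.add_smul_sub_mem hyU hyvU htI
        simpa using this
      have hd : HasDerivAt (fun t : ℝ => w (y + t • v)) (fderiv ℝ w (y + t • v) v) t := by
        have hg : HasDerivAt (fun t : ℝ => y + t • v) v t := by
          simpa using ((hasDerivAt_id t).smul_const v).const_add y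
        exact ht.1.hasFDerivAt.comp_hasDerivAt t hg
      rw [hd.deriv]
      exact ht.2 hmem
    rw [hftc] at hle
    simpa using hle
  have hdense := Measure.dense_of_ae hinc
  have hV : IsOpen (U ∩ (fun y => y + v) ⁻¹' U) :=
    hUo.inter (hUo.preimage (continuous_id.add continuous_const))
  have hcl : x ∈ closure ((U ∩ (fun y => y + v) ⁻¹' U) ∩
      {y | y ∈ U → y + v ∈ U → w (y + v) - w y ≤ α}) :=
    hdense.open_subset_closure_inter hV ⟨hx, hxv⟩
  have hwc := hw.continuous
  have hclosed : IsClosed {y : Euc N | w (y + v) - w y ≤ α} :=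
    isClosed_le (by fun_prop) continuous_const
  exact closure_minimal (fun y hy => hy.2 hy.1.1 hy.1.2) hclosed hcl

/-- An a.e. gradient bound on a ball makes a locally Lipschitz function Lipschitz there. -/
theorem LocallyLipschitz.abs_sub_le_of_ae_norm_gradient_le {N : ℕ} {w : Euc N → ℝ}
    (hw : LocallyLipschitz w) {R r : ℝ}
    (h : ∀ᵐ x : Euc N ∂volume, x ∈ Metric.ball (0 : Euc N) R → ‖gradient w x‖ ≤ r)
    {x y : Euc N} (hx : x ∈ Metric.ball (0 : Euc N) R) (hy : y ∈ Metric.ball (0 : Euc N) R) :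
    |w x - w y| ≤ r * ‖x - y‖ := by
  have key {x y : Euc N} (hx : x ∈ Metric.ball (0 : Euc N) R)
      (hy : y ∈ Metric.ball (0 : Euc N) R) : w x - w y ≤ r * ‖x - y‖ := by
    have := hw.sub_le_of_ae_fderiv_le (v := x - y) (α := r * ‖x - y‖) Metric.isOpen_ball
      (convex_ball (0 : Euc N) R) ?_ hy (by simpa using hx)
    · simpa using this
    · filter_upwards [h] with z hz hzR
      rw [← inner_gradient_left]
      exact (real_inner_le_norm _ _).trans
        (mul_le_mul_of_nonneg_right (hz hzR) (norm_nonneg _))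
  refine abs_le.2 ⟨?_, key hx hy⟩
  have := key hy hx
  rw [norm_sub_rev] at this
  linarith

/-- A linear form bounded on a sublevel set of `H (x₀, ·)` stays bounded on the nearby sublevel
sets at nearby points. -/
theorem eventually_sublevel_lt {N : ℕ} {H : Euc N × Euc N → ℝ} (hA1 : Continuous H)
    (hA2coer : ∀ R : ℝ, 0 < R → ∀ C : ℝ, ∃ r : ℝ, ∀ x p : Euc N,
      ‖x‖ ≤ R → r ≤ ‖p‖ → C ≤ H (x, p))
    {x₀ : Euc N} {c α : ℝ} {f : StrongDual ℝ (Euc N)} (hf : ∀ q, H (x₀, q) ≤ c → f q < α) :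
    ∀ᶠ z : Euc N × ℝ in 𝓝 (x₀, c), ∀ q, H (z.1, q) ≤ z.2 → f q < α := by
  obtain ⟨r, hr⟩ := hA2coer (‖x₀‖ + 1) (by positivity) (c + 2)
  have hK : IsCompact (Metric.closedBall (0 : Euc N) r ∩ {q | α ≤ f q}) :=
    (isCompact_closedBall _ _).inter_right (isClosed_le continuous_const f.continuous)
  have h1 : ∀ᶠ z : Euc N × ℝ in 𝓝 (x₀, c),
      ∀ q ∈ Metric.closedBall (0 : Euc N) r ∩ {q | α ≤ f q}, z.2 < H (z.1, q) := by
    refine hK.eventually_forall_of_forall_eventually fun q hq => ?_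
    have hlt : c < H (x₀, q) := by
      by_contra! hcon
      exact absurd (hf q hcon) (not_lt.2 hq.2)
    have ho : IsOpen {y : (Euc N × ℝ) × Euc N | y.1.2 < H (y.1.1, y.2)} :=
      isOpen_lt (by fun_prop) (by fun_prop)
    exact ho.mem_nhds hlt
  have h2 : ∀ᶠ z : Euc N × ℝ in 𝓝 (x₀, c), ‖z.1‖ < ‖x₀‖ + 1 ∧ z.2 < c + 1 := by
    have ho₁ : IsOpen {z : Euc N × ℝ | ‖z.1‖ < ‖x₀‖ + 1} :=
      isOpen_lt (by fun_prop) (by fun_prop)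
    have ho₂ : IsOpen {z : Euc N × ℝ | z.2 < c + 1} := isOpen_lt (by fun_prop) (by fun_prop)
    exact Filter.Eventually.and (ho₁.mem_nhds (by simp)) (ho₂.mem_nhds (by simp))
  filter_upwards [h1, h2] with z hz1 hz2 q hq
  by_contra! hcon
  rcases le_total r ‖q‖ with hrq | hrq
  · linarith [hr z.1 q hz2.1.le hrq, hz2.2]
  · exact absurd hq (not_le.2 (hz1 q ⟨by simpa using hrq, hcon⟩))

/-- Pointwise limits of subsolutions at levels converging to `c` are subsolutions at level `c`, at
every differentiability point of the limit. -/
theorem le_of_tendsto_subsol {N : ℕ} {H : Euc N × Euc N → ℝ} (hA1 : Continuous H)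
    (hA2conv : ∀ x : Euc N, ConvexOn ℝ Set.univ fun p => H (x, p))
    (hA2coer : ∀ R : ℝ, 0 < R → ∀ C : ℝ, ∃ r : ℝ, ∀ x p : Euc N,
      ‖x‖ ≤ R → r ≤ ‖p‖ → C ≤ H (x, p))
    {ι : Type*} {l : Filter ι} [l.NeBot] {a : ι → ℝ} {w : ι → Euc N → ℝ} {c : ℝ}
    {u : Euc N → ℝ} (ha : Tendsto a l (𝓝 c)) (hw : ∀ i, IsSubsol H (a i) (w i))
    (hu : ∀ x, Tendsto (fun i => w i x) l (𝓝 (u x))) {x₀ : Euc N}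
    (hd : DifferentiableAt ℝ u x₀) : H (x₀, gradient u x₀) ≤ c := by
  by_contra! hcon
  have hconv : Convex ℝ {q | H (x₀, q) ≤ c} := by
    simpa using (hA2conv x₀).convex_le c
  have hclosed : IsClosed {q | H (x₀, q) ≤ c} := isClosed_le (by fun_prop) continuous_const
  obtain ⟨f, α, hfα, hα⟩ := geometric_hahn_banach_closed_point hconv hclosed
    (x := gradient u x₀) (not_le.2 hcon)
  obtain ⟨v, rfl⟩ := (InnerProductSpace.toDual ℝ (Euc N)).surjective f
  have hev := eventually_sublevel_lt hA1 hA2coer hfα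
  rw [nhds_prod_eq, eventually_prod_iff] at hev
  obtain ⟨pa, hpa, pb, hpb, hab⟩ := hev
  obtain ⟨δ, hδ, hball⟩ := Metric.eventually_nhds_iff_ball.1 hpa
  have hinc {t : ℝ} (ht : 0 < t) (hmem : x₀ + t • v ∈ Metric.ball x₀ δ) :
      u (x₀ + t • v) - u x₀ ≤ t * α := by
    refine le_of_tendsto ((hu (x₀ + t • v)).sub (hu x₀)) ?_
    filter_upwards [ha.eventually hpb] with i hi
    refine (hw i).1.sub_le_of_ae_fderiv_le Metric.isOpen_ball (convex_ball x₀ δ) ?_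
      (Metric.mem_ball_self hδ) hmem
    filter_upwards [(hw i).2, (hw i).1.ae_differentiableAt_euc] with y hy hyd hyb
    have := hab (hball y hyb) hi _ (hy hyd)
    rw [map_smul, smul_eq_mul, ← inner_gradient_left, real_inner_comm]
    exact mul_le_mul_of_nonneg_left this.le ht.le
  have hslope : HasDerivAt (fun t : ℝ => u (x₀ + t • v)) (fderiv ℝ u x₀ v) 0 := by
    have hg : HasDerivAt (fun t : ℝ => x₀ + t • v) v 0 := by
      simpa using ((hasDerivAt_id (0 : ℝ)).smul_const v).const_add x₀
    have hd' : HasFDerivAt u (fderiv ℝ u x₀) (x₀ + (0 : ℝ) • v) := by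
      simpa using hd.hasFDerivAt
    exact hd'.comp_hasDerivAt 0 hg
  have hle : fderiv ℝ u x₀ v ≤ α := by
    refine le_of_tendsto (hslope.tendsto_slope_zero_right) ?_
    have hcont : Tendsto (fun t : ℝ => x₀ + t • v) (𝓝[>] 0) (𝓝 x₀) := by
      have : Continuous (fun t : ℝ => x₀ + t • v) := by fun_prop
      simpa using (this.tendsto 0).mono_left nhdsWithin_le_nhds
    filter_upwards [self_mem_nhdsWithin, hcont.eventually (Metric.ball_mem_nhds x₀ hδ)]
      with t ht hmem
    have ht' : (0 : ℝ) < t := ht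
    have := hinc ht' hmem
    simp only [zero_add, zero_smul, add_zero, smul_eq_mul]
    rw [inv_mul_le_iff₀ ht']
    exact this
  rw [InnerProductSpace.toDual_apply_apply, real_inner_comm, inner_gradient_left] at hα
  linarith

/-- A continuous coercive Hamiltonian is bounded below over each ball. -/
theorem exists_forall_le_of_coercive {N : ℕ} {H : Euc N × Euc N → ℝ} (hA1 : Continuous H)
    (hA2coer : ∀ R : ℝ, 0 < R → ∀ C : ℝ, ∃ r : ℝ, ∀ x p : Euc N,
      ‖x‖ ≤ R → r ≤ ‖p‖ → C ≤ H (x, p)) (R : ℝ) (hR : 0 < R) :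
    ∃ b : ℝ, ∀ x p : Euc N, ‖x‖ ≤ R → b ≤ H (x, p) := by
  obtain ⟨r, hr⟩ := hA2coer R hR 0
  obtain ⟨b, hb⟩ := ((isCompact_closedBall (0 : Euc N) R).prod
    (isCompact_closedBall (0 : Euc N) r)).bddBelow_image hA1.continuousOn
  refine ⟨min b 0, fun x p hx => ?_⟩
  rcases le_total r ‖p‖ with hp | hp
  · exact (min_le_right _ _).trans (hr x p hx hp)
  · exact (min_le_left _ _).trans
      (hb ⟨(x, p), ⟨by simpa using hx, by simpa using hp⟩, rfl⟩)

theorem bddBelow_setOf_exists_isSubsol {N : ℕ} {H : Euc N × Euc N → ℝ} (hA1 : Continuous H)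
    (hA2coer : ∀ R : ℝ, 0 < R → ∀ C : ℝ, ∃ r : ℝ, ∀ x p : Euc N,
      ‖x‖ ≤ R → r ≤ ‖p‖ → C ≤ H (x, p)) :
    BddBelow {a : ℝ | ∃ u : Euc N → ℝ, IsSubsol H a u} := by
  obtain ⟨b, hb⟩ := exists_forall_le_of_coercive hA1 hA2coer 1 one_pos
  refine ⟨b, ?_⟩
  rintro a ⟨u, hu, hua⟩
  have hae : ∀ᵐ x : Euc N ∂volume, H (x, gradient u x) ≤ a := by
    filter_upwards [hua, hu.ae_differentiableAt_euc] with x hx hxd using hx hxd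
  obtain ⟨x, hxb, hx⟩ := (Measure.dense_of_ae hae).inter_open_nonempty
    (Metric.ball (0 : Euc N) 1) Metric.isOpen_ball ⟨0, by simp⟩
  exact (hb x _ (by simpa using Metric.ball_subset_closedBall hxb)).trans hx

theorem IsSubsol.sub_const {N : ℕ} {H : Euc N × Euc N → ℝ} {a : ℝ} {u : Euc N → ℝ}
    (h : IsSubsol H a u) (k : ℝ) : IsSubsol H a fun x => u x - k := by
  refine ⟨fun x => ?_, ?_⟩
  · obtain ⟨K, t, ht, hK⟩ := h.1 x
    refine ⟨K, t, ht, fun y hy z hz => ?_⟩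
    simpa using hK hy hz
  · filter_upwards [h.2] with x hx hd
    have hd' : DifferentiableAt ℝ u x := by simpa using hd
    have : gradient (fun x => u x - k) x = gradient u x := by
      simp [gradient, fderiv_sub_const]
    rw [this]
    exact hx hd'

/-- A limit of bounded above levels admitting subsolutions admits a subsolution. -/
theorem exists_isSubsol_of_tendsto {N : ℕ} {H : Euc N × Euc N → ℝ} (hA1 : Continuous H)
    (hA2conv : ∀ x : Euc N, ConvexOn ℝ Set.univ fun p => H (x, p))
    (hA2coer : ∀ R : ℝ, 0 < R → ∀ C : ℝ, ∃ r : ℝ, ∀ x p : Euc N,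
      ‖x‖ ≤ R → r ≤ ‖p‖ → C ≤ H (x, p))
    {a : ℕ → ℝ} {c A : ℝ} (ha : Tendsto a atTop (𝓝 c)) (haA : ∀ n, a n ≤ A)
    (hex : ∀ n, ∃ u, IsSubsol H (a n) u) : ∃ u, IsSubsol H c u := by
  choose u₀ hu₀ using hex
  set w : ℕ → Euc N → ℝ := fun n x => u₀ n x - u₀ n 0 with hw_def
  have hw (n : ℕ) : IsSubsol H (a n) (w n) := (hu₀ n).sub_const _
  have hlip (R : ℝ) (hR : 0 < R) : ∃ r : ℝ, ∀ n, ∀ x ∈ Metric.ball (0 : Euc N) R,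
      ∀ y ∈ Metric.ball (0 : Euc N) R, |w n x - w n y| ≤ r * ‖x - y‖ := by
    obtain ⟨r, hr⟩ := hA2coer R hR (A + 1)
    refine ⟨r, fun n x hx y hy => (hw n).1.abs_sub_le_of_ae_norm_gradient_le ?_ hx hy⟩
    filter_upwards [(hw n).2, (hw n).1.ae_differentiableAt_euc] with z hz hzd hzR
    by_contra! hcon
    have hzR' : ‖z‖ ≤ R := by simpa using Metric.ball_subset_closedBall hzR
    linarith [hr z _ hzR' hcon.le, hz hzd, haA n]
  let l : Ultrafilter ℕ := Ultrafilter.of atTop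
  have hlim (x : Euc N) : ∃ b : ℝ, Tendsto (fun n => w n x) l (𝓝 b) := by
    obtain ⟨r, hr⟩ := hlip (‖x‖ + 1) (by positivity)
    have hmem (n : ℕ) : w n x ∈ Icc (-(r * ‖x‖)) (r * ‖x‖) := by
      have := hr n x (by simp) 0 (by simp; positivity)
      exact abs_le.1 (by simpa [hw_def] using this)
    obtain ⟨b, -, hb⟩ := (isCompact_Icc (a := -(r * ‖x‖)) (b := r * ‖x‖)).ultrafilter_le_nhds
      (l.map fun n => w n x) (by
        rw [le_principal_iff]
        exact Eventually.of_forall (f := (l : Filter ℕ)) hmem)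
    exact ⟨b, hb⟩
  choose u hu using hlim
  refine ⟨u, fun x => ?_, Eventually.of_forall fun x hd =>
    le_of_tendsto_subsol hA1 hA2conv hA2coer (ha.mono_left (Ultrafilter.of_le _)) hw hu hd⟩
  obtain ⟨r, hr⟩ := hlip (‖x‖ + 1) (by positivity)
  refine ⟨r.toNNReal, Metric.ball 0 (‖x‖ + 1), Metric.isOpen_ball.mem_nhds (by simp),
    LipschitzOnWith.of_dist_le_mul fun y hy z hz => ?_⟩
  rw [Real.dist_eq, dist_eq_norm]
  refine (le_of_tendsto ((hu y).sub (hu z)).abs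
    (Eventually.of_forall fun n => hr n y hy z hz)).trans ?_
  exact mul_le_mul_of_nonneg_right (Real.le_coe_toNNReal r) (norm_nonneg _)

theorem exists_isSubsol_zero {N : ℕ} {H : Euc N × Euc N → ℝ} (hA1 : Continuous H)
    {R m : ℝ} (h : ∀ x : Euc N, R ≤ ‖x‖ → H (x, 0) ≤ m) :
    ∃ a, IsSubsol H a fun _ => 0 := by
  obtain ⟨b, hb⟩ := (isCompact_closedBall (0 : Euc N) R).bddAbove_image
    (f := fun x => H (x, 0)) (by fun_prop)
  refine ⟨max b m, LocallyLipschitz.const 0, Eventually.of_forall fun x _ => ?_⟩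
  have : gradient (fun _ : Euc N => (0 : ℝ)) x = 0 := by simp [gradient]
  rw [this]
  rcases le_total R ‖x‖ with hx | hx
  · exact (h x hx).trans (le_max_right _ _)
  · exact (hb ⟨x, by simpa using hx, rfl⟩).trans (le_max_left _ _)

theorem stmt1 {N : ℕ} (hN : 1 ≤ N) (H : Euc N × Euc N → ℝ)
    (hA1 : Continuous H)
    (hA2conv : ∀ x : Euc N, ConvexOn ℝ Set.univ fun p => H (x, p))
    (hA2coer : ∀ R : ℝ, 0 < R → ∀ C : ℝ, ∃ r : ℝ, ∀ x p : Euc N,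
      ‖x‖ ≤ R → r ≤ ‖p‖ → C ≤ H (x, p))
    (hA3 : ∃ ε > (0 : ℝ), ∃ m : ℝ,
      (∃ R : ℝ, ∀ x : Euc N, R ≤ ‖x‖ → ∀ p : Euc N, ‖p‖ ≤ ε → H (x, p) ≤ m) ∧
      (∃ x₀ : Euc N, ∀ p : Euc N, m < H (x₀, p)))
 :
    {a : ℝ | ∃ u : Euc N → ℝ, IsSubsol H a u}.Nonempty ∧
    BddBelow {a : ℝ | ∃ u : Euc N → ℝ, IsSubsol H a u} ∧
    sInf {a : ℝ | ∃ u : Euc N → ℝ, IsSubsol H a u} ∈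
      {a : ℝ | ∃ u : Euc N → ℝ, IsSubsol H a u} := by
  obtain ⟨ε, hε, m, ⟨R, hR⟩, -⟩ := hA3
  have hne : {a : ℝ | ∃ u : Euc N → ℝ, IsSubsol H a u}.Nonempty := by
    obtain ⟨a, ha⟩ := exists_isSubsol_zero hA1 (R := R) (m := m)
      fun x hx => hR x hx 0 (by simpa using hε.le)
    exact ⟨a, _, ha⟩
  have hbdd := bddBelow_setOf_exists_isSubsol hA1 hA2coer
  obtain ⟨a, hanti, ha, hmem⟩ := exists_seq_tendsto_sInf hne hbdd
  exact ⟨hne, hbdd, exists_isSubsol_of_tendsto hA1 hA2conv hA2coer ha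
    (fun n => hanti (Nat.zero_le n)) hmem⟩

end
end

section
/- Given z ∈ ℝ^N, λ > 0, a ∈ ℝ and an open ball B containing z, there exists R > 1 such that every Lipschitz function u : B → ℝ with u(z) ≥ a satisfying λ u(x) + Du(x)·q ≤ L(x,q) for a.e. x ∈ B and every q with |q| ≤ R in fact satisfies λ u(x) + Du(x)·q ≤ L(x,q) for a.e. x ∈ B and every q ∈ ℝ^N (equivalently, λ u(x) + H(x,Du(x)) ≤ 0 for a.e. x ∈ B). -/
open MeasureTheory Set
open scoped RealInnerProductSpace

noncomputable section

/-- Gronwall's inequality for a Lipschitz function satisfying `g' ≤ c g` almost everywhere. -/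
theorem LipschitzOnWith.le_exp_mul_of_ae_deriv_le {g : ℝ → ℝ} {K : NNReal} {c : ℝ}
    (hg : LipschitzOnWith K g (Icc 0 1))
    (h : ∀ᵐ t : ℝ, t ∈ Icc (0 : ℝ) 1 → deriv g t ≤ c * g t) :
    g 1 ≤ Real.exp c * g 0 := by
  have hgac : AbsolutelyContinuousOnInterval g 0 1 :=
    LipschitzOnWith.absolutelyContinuousOnInterval (by rwa [uIcc_of_le zero_le_one])
  have hexp : ContDiff ℝ 1 fun t : ℝ => Real.exp (-c * t) := by fun_prop
  obtain ⟨K', hK'⟩ := hexp.contDiffOn.exists_lipschitzOnWith one_ne_zero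
    (convex_uIcc (0 : ℝ) 1) isCompact_uIcc
  have hint := hK'.absolutelyContinuousOnInterval.integral_deriv_mul_eq_sub hgac
  have hderiv (t : ℝ) : deriv (fun t : ℝ => Real.exp (-c * t)) t = -c * Real.exp (-c * t) := by
    have : HasDerivAt (fun t : ℝ => Real.exp (-c * t)) (Real.exp (-c * t) * (-c * 1)) t :=
      ((hasDerivAt_id t).const_mul (-c)).exp
    rw [this.deriv]; ring
  have hle : ∫ t in (0 : ℝ)..1, (deriv (fun t : ℝ => Real.exp (-c * t)) t * g t
      + Real.exp (-c * t) * deriv g t) ≤ 0 := by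
    rw [intervalIntegral.integral_of_le zero_le_one]
    refine integral_nonpos_of_ae ?_
    rw [Filter.EventuallyLE, ae_restrict_iff' measurableSet_Ioc]
    filter_upwards [h] with t ht htm
    have := ht (Ioc_subset_Icc_self htm)
    rw [hderiv]
    have := mul_le_mul_of_nonneg_left this (Real.exp_pos (-c * t)).le
    simp only [Pi.zero_apply]
    linarith
  rw [hint] at hle
  have hmul : Real.exp c * (Real.exp (-c) * g 1) ≤ Real.exp c * g 0 :=
    mul_le_mul_of_nonneg_left (by simpa using hle) (Real.exp_pos c).le
  rwa [← mul_assoc, ← Real.exp_add, add_neg_cancel, Real.exp_zero, one_mul] at hmul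

section Gronwall

variable {E : Type*} [NormedAddCommGroup E] [NormedSpace ℝ E] [FiniteDimensional ℝ E]
  [MeasurableSpace E] [BorelSpace E]

/-- A Lipschitz function on a convex open set satisfying `‖Dv‖ ≤ k v` almost everywhere grows at
most exponentially. -/
theorem LipschitzOnWith.le_exp_mul_dist_of_ae_norm_fderiv_le (μ : Measure E) [μ.IsAddHaarMeasure]
    {v : E → ℝ} {B : Set E} {K : NNReal} {k : ℝ} (hv : LipschitzOnWith K v B)
    (hBo : IsOpen B) (hBc : Convex ℝ B)
    (h : ∀ᵐ x ∂μ, x ∈ B → ‖fderiv ℝ v x‖ ≤ k * v x) {x z : E} (hx : x ∈ B) (hz : z ∈ B) :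
    v x ≤ Real.exp (k * dist x z) * v z := by
  set e := x - z with he
  have hae : ∀ᵐ y ∂μ, y ∈ B → DifferentiableAt ℝ v y ∧ ‖fderiv ℝ v y‖ ≤ k * v y := by
    filter_upwards [h, hv.ae_differentiableWithinAt_of_mem (μ := μ)] with y hy hd hyB
    exact ⟨(hd hyB).differentiableAt (hBo.mem_nhds hyB), hy hyB⟩
  obtain ⟨s, hs, hsm, hs0⟩ := exists_measurable_superset_of_null (ae_iff.1 hae)
  have hsc : ∀ᵐ y ∂μ, y ∈ sᶜ := by
    rw [ae_iff]
    simpa using hs0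
  have hline : ∀ᵐ y ∂μ, ∀ᵐ t : ℝ, y + LinearMap.toSpanSingleton ℝ E e t ∈ sᶜ :=
    (ae_ae_add_linearMap_mem_iff (LinearMap.toSpanSingleton ℝ E e) volume μ hsm.compl).2 hsc
  have hkey : ∀ᵐ y ∂μ, y ∈ B → y + e ∈ B → v (y + e) ≤ Real.exp (k * ‖e‖) * v y := by
    filter_upwards [hline] with y hy hyB hyeB
    have hmem : ∀ t ∈ Icc (0 : ℝ) 1, y + t • e ∈ B := fun t ht => by
      have := hBc.add_smul_sub_mem hyB hyeB ht
      rwa [add_sub_cancel_left] at this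
    have hlip : LipschitzOnWith (K * ‖e‖₊) (fun t : ℝ => v (y + t • e)) (Icc 0 1) := by
      refine hv.comp (LipschitzWith.lipschitzOnWith ?_) hmem
      refine LipschitzWith.of_dist_le_mul fun t t' => ?_
      rw [dist_add_left, dist_eq_norm, ← sub_smul, norm_smul, mul_comm, Real.dist_eq]
      simp
    have := hlip.le_exp_mul_of_ae_deriv_le (c := k * ‖e‖) ?_
    · simpa using this
    filter_upwards [hy] with t ht htm
    obtain ⟨hd, hle⟩ : DifferentiableAt ℝ v (y + t • e) ∧
        ‖fderiv ℝ v (y + t • e)‖ ≤ k * v (y + t • e) := by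
      by_contra hcon
      exact ht (hs fun hall => hcon (hall (hmem t htm)))
    have hl : HasDerivAt (fun t : ℝ => y + t • e) e t := by
      simpa using ((hasDerivAt_id t).smul_const e).const_add y
    have hcomp : HasDerivAt (fun t : ℝ => v (y + t • e)) (fderiv ℝ v (y + t • e) e) t :=
      hd.hasFDerivAt.comp_hasDerivAt t hl
    rw [hcomp.deriv]
    calc fderiv ℝ v (y + t • e) e ≤ ‖fderiv ℝ v (y + t • e)‖ * ‖e‖ :=
          (le_abs_self _).trans ((fderiv ℝ v (y + t • e)).le_opNorm e)
      _ ≤ k * v (y + t • e) * ‖e‖ := by gcongr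
      _ = k * ‖e‖ * v (y + t • e) := by ring
  have hze : z + e = x := by rw [he]; abel
  by_contra! hlt
  rw [dist_eq_norm, ← he] at hlt
  have hcz : ContinuousAt v z := hv.continuousOn.continuousAt (hBo.mem_nhds hz)
  have hcx : ContinuousAt (fun y => v (y + e)) z := by
    refine ContinuousAt.comp (g := v) ?_ (by fun_prop)
    rw [hze]
    exact hv.continuousOn.continuousAt (hBo.mem_nhds hx)
  have hnear : ∀ᶠ y in nhds z, y ∈ B ∧ y + e ∈ B ∧ Real.exp (k * ‖e‖) * v y < v (y + e) := by
    refine (hBo.eventually_mem hz).and (Filter.Eventually.and ?_ ?_)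
    · refine (continuous_add_const e).continuousAt.eventually_mem (hBo.mem_nhds ?_)
      rwa [hze]
    · refine (continuousAt_const.mul hcz).eventually_lt hcx ?_
      rwa [hze]
  obtain ⟨y, ⟨hyB, hyeB, hylt⟩, hy⟩ := (Measure.dense_of_ae hkey).inter_nhds_nonempty hnear |>.imp
    fun y hy => hy.symm
  exact (hy hyB hyeB).not_gt hylt

end Gronwall

section Lagrangian

variable {N : ℕ} {H : Euc N × Euc N → ℝ}

/-- A continuous function is bounded in absolute value on products of balls. -/
theorem Continuous.exists_abs_le_of_dist_le_of_norm_le (hA1 : Continuous H) (x₀ : Euc N)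
    (ρ r : ℝ) : ∃ C : ℝ, ∀ x p : Euc N, dist x x₀ ≤ ρ → ‖p‖ ≤ r → |H (x, p)| ≤ C := by
  obtain ⟨C, hC⟩ := ((isCompact_closedBall x₀ ρ).prod
    (isCompact_closedBall (0 : Euc N) r)).exists_bound_of_continuousOn hA1.continuousOn
  exact ⟨C, fun x p hx hp => hC (x, p) ⟨hx, by simpa using hp⟩⟩

/-- The supremum defining the Lagrangian of a superlinear Hamiltonian is over a bounded set. -/
theorem bddAbove_range_inner_sub (hA1 : Continuous H)
    (hsl : ∀ x : Euc N, ∀ C : ℝ, ∃ r : ℝ, ∀ p : Euc N, r ≤ ‖p‖ → C * ‖p‖ ≤ H (x, p))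
    (x q : Euc N) : BddAbove (Set.range fun p : Euc N => ⟪p, q⟫ - H (x, p)) := by
  obtain ⟨r, hr⟩ := hsl x ‖q‖
  obtain ⟨C, hC⟩ := hA1.exists_abs_le_of_dist_le_of_norm_le x 0 r
  refine ⟨max 0 (r * ‖q‖ + C), ?_⟩
  rintro _ ⟨p, rfl⟩
  have hpq := real_inner_le_norm p q
  rcases le_total r ‖p‖ with hp | hp
  · exact le_max_of_le_left (by linarith [hr p hp])
  · have := (abs_le.1 (hC x p (by simp) hp)).1
    have := mul_le_mul_of_nonneg_right hp (norm_nonneg q)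
    exact le_max_of_le_right (by linarith)

/-- A coercive convex Hamiltonian grows at least linearly, locally uniformly in `x`. -/
theorem exists_mul_norm_sub_le (hA1 : Continuous H)
    (hA2conv : ∀ x : Euc N, ConvexOn ℝ Set.univ fun p => H (x, p))
    (hA2coer : ∀ R : ℝ, 0 < R → ∀ C : ℝ, ∃ r : ℝ, ∀ x p : Euc N,
      ‖x‖ ≤ R → r ≤ ‖p‖ → C ≤ H (x, p))
    (x₀ : Euc N) {ρ : ℝ} (hρ : 0 < ρ) :
    ∃ δ : ℝ, 0 < δ ∧ δ ≤ 1 ∧ ∃ C : ℝ, ∀ x p : Euc N, dist x x₀ ≤ ρ →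
      δ * ‖p‖ - H (x, p) ≤ C := by
  obtain ⟨C₀, hC₀⟩ := hA1.exists_abs_le_of_dist_le_of_norm_le x₀ ρ 0
  obtain ⟨s, hs⟩ := hA2coer (‖x₀‖ + ρ) (by positivity) (C₀ + 1)
  set r := max s 1
  have hr1 : 1 ≤ r := le_max_right _ _
  have hr0 : 0 < r := by linarith
  obtain ⟨C₁, hC₁⟩ := hA1.exists_abs_le_of_dist_le_of_norm_le x₀ ρ r
  refine ⟨r⁻¹, by positivity, inv_le_one_of_one_le₀ hr1, max (-C₀) (1 + C₁),
    fun x p hx => ?_⟩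
  rcases le_total r ‖p‖ with hp | hp
  · have hp0 : 0 < ‖p‖ := by linarith
    set t := r / ‖p‖ with ht
    have ht0 : 0 < t := by positivity
    have ht1 : t ≤ 1 := (div_le_one hp0).2 hp
    have hnorm : ‖t • p‖ = r := by
      rw [norm_smul, Real.norm_of_nonneg ht0.le, ht]
      field_simp
    have hxn : ‖x‖ ≤ ‖x₀‖ + ρ := by
      have := norm_le_norm_add_norm_sub' x x₀
      rw [← dist_eq_norm] at this
      linarith
    have hlow := hs x (t • p) hxn (by rw [hnorm]; exact le_max_left _ _)
    have hconv := (hA2conv x).2 (mem_univ p) (mem_univ 0) ht0.le (sub_nonneg.2 ht1)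
      (by ring)
    simp only [smul_zero, add_zero, smul_eq_mul] at hconv
    have hzero := (abs_le.1 (hC₀ x 0 hx (by simp))).2
    have := mul_le_mul_of_nonneg_left hzero (sub_nonneg.2 ht1)
    have htH : t * (r⁻¹ * ‖p‖ + C₀) ≤ t * H (x, p) := by
      have : t * (r⁻¹ * ‖p‖) = 1 := by rw [ht]; field_simp
      rw [mul_add, this]
      linarith
    have := le_of_mul_le_mul_left htH ht0
    exact le_max_of_le_left (by linarith)
  · have := (abs_le.1 (hC₁ x p hx hp)).1
    have : r⁻¹ * ‖p‖ ≤ 1 := by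
      rw [inv_mul_le_iff₀ hr0]; linarith
    exact le_max_of_le_right (by linarith)

/-- The Lagrangian is bounded above on small velocities where `H` grows at least linearly. -/
theorem Lag_le_of_mul_norm_sub_le {δ C : ℝ} {x q : Euc N}
    (h : ∀ p : Euc N, δ * ‖p‖ - H (x, p) ≤ C) (hq : ‖q‖ ≤ δ) : Lag H (x, q) ≤ C := by
  refine csSup_le (range_nonempty _) ?_
  rintro _ ⟨p, rfl⟩
  have h₁ := real_inner_le_norm p q
  have h₂ := mul_le_mul_of_nonneg_left hq (norm_nonneg p)
  have h₃ := h p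
  simp only
  linarith

/-- The Lagrangian is bounded below by affine functions of the speed. -/
theorem mul_norm_sub_le_Lag (hA1 : Continuous H)
    (hsl : ∀ x : Euc N, ∀ C : ℝ, ∃ r : ℝ, ∀ p : Euc N, r ≤ ‖p‖ → C * ‖p‖ ≤ H (x, p))
    {P C : ℝ} (hP : 0 ≤ P) {x q : Euc N} (h : ∀ p : Euc N, ‖p‖ ≤ P → H (x, p) ≤ C) (hq : q ≠ 0) :
    P * ‖q‖ - C ≤ Lag H (x, q) := by
  have hq0 : 0 < ‖q‖ := norm_pos_iff.2 hq
  have hle : ⟪(P / ‖q‖) • q, q⟫ - H (x, (P / ‖q‖) • q) ≤ Lag H (x, q) :=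
    le_csSup (bddAbove_range_inner_sub hA1 hsl x q) ⟨(P / ‖q‖) • q, rfl⟩
  have hnorm : ‖(P / ‖q‖) • q‖ ≤ P := by
    rw [norm_smul, Real.norm_of_nonneg (by positivity)]
    field_simp
    exact le_rfl
  have hinner : ⟪(P / ‖q‖) • q, q⟫ = P * ‖q‖ := by
    rw [real_inner_smul_left, real_inner_self_eq_norm_sq]
    field_simp
  have := h _ hnorm
  linarith

end Lagrangian

/-- A bound on a continuous linear form on a ball bounds its norm. -/
theorem ContinuousLinearMap.mul_norm_le_of_forall_apply_le {E : Type*} [NormedAddCommGroup E]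
    [NormedSpace ℝ E] (f : E →L[ℝ] ℝ) {δ M : ℝ} (hδ : 0 < δ)
    (h : ∀ q : E, ‖q‖ ≤ δ → f q ≤ M) : δ * ‖f‖ ≤ M := by
  have hM : 0 ≤ M := by simpa using h 0 (by simpa using hδ.le)
  rw [mul_comm, ← le_div_iff₀ hδ]
  refine f.opNorm_le_of_unit_norm (by positivity) fun q hq => ?_
  rw [Real.norm_eq_abs, abs_le, le_div_iff₀ hδ, ← neg_le_neg_iff, neg_neg]
  have h₁ := h (δ • q) (by simp [norm_smul, hq, abs_of_pos hδ])
  have h₂ := h (-(δ • q)) (by simp [norm_smul, hq, abs_of_pos hδ])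
  simp only [map_neg, map_smul, smul_eq_mul] at h₁ h₂
  constructor
  · rw [le_div_iff₀ hδ]; linarith
  · linarith

theorem stmt6 {N : ℕ} (hN : 1 ≤ N) (H : Euc N × Euc N → ℝ)
    (hA1 : Continuous H)
    (hA2conv : ∀ x : Euc N, ConvexOn ℝ Set.univ fun p => H (x, p))
    (hA2coer : ∀ R : ℝ, 0 < R → ∀ C : ℝ, ∃ r : ℝ, ∀ x p : Euc N,
      ‖x‖ ≤ R → r ≤ ‖p‖ → C ≤ H (x, p))
    (hA3 : ∃ ε > (0 : ℝ), ∃ m : ℝ,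
      (∃ R : ℝ, ∀ x : Euc N, R ≤ ‖x‖ → ∀ p : Euc N, ‖p‖ ≤ ε → H (x, p) ≤ m) ∧
      (∃ x₀ : Euc N, ∀ p : Euc N, m < H (x₀, p)))
    (hcrit : sInf {a : ℝ | ∃ u : Euc N → ℝ, IsSubsol H a u} = 0)
    (hsl : ∀ x : Euc N, ∀ C : ℝ, ∃ r : ℝ, ∀ p : Euc N, r ≤ ‖p‖ → C * ‖p‖ ≤ H (x, p))
    (z : Euc N) (lam : ℝ) (hlam : 0 < lam) (a : ℝ)
    (x₀ : Euc N) (ρ : ℝ) (hρ : 0 < ρ) (hz : z ∈ Metric.ball x₀ ρ) :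
    ∃ R : ℝ, 1 < R ∧ ∀ u : Euc N → ℝ,
      (∃ K : NNReal, LipschitzOnWith K u (Metric.ball x₀ ρ)) → a ≤ u z →
      (∀ᵐ x : Euc N ∂volume, x ∈ Metric.ball x₀ ρ → DifferentiableAt ℝ u x →
        ∀ q : Euc N, ‖q‖ ≤ R → lam * u x + fderiv ℝ u x q ≤ Lag H (x, q)) →
      (∀ᵐ x : Euc N ∂volume, x ∈ Metric.ball x₀ ρ → DifferentiableAt ℝ u x →
        ∀ q : Euc N, lam * u x + fderiv ℝ u x q ≤ Lag H (x, q)) := by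
  obtain ⟨δ, hδ, hδ1, C₁, hC₁⟩ := exists_mul_norm_sub_le hA1 hA2conv hA2coer x₀ hρ
  set k := lam / δ with hk
  have hk0 : 0 < k := by positivity
  set V := Real.exp (k * (2 * ρ)) * max (C₁ - lam * a) 0 with hV
  have hV0 : 0 ≤ V := by positivity
  set P := V / δ with hP
  have hP0 : 0 ≤ P := by positivity
  obtain ⟨C₂, hC₂⟩ := hA1.exists_abs_le_of_dist_le_of_norm_le x₀ ρ (P + 1)
  refine ⟨max 2 (C₁ + C₂), lt_max_of_lt_left one_lt_two, ?_⟩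
  rintro u ⟨K, hu⟩ hua hsub
  have hgrad : ∀ᵐ x : Euc N ∂volume, x ∈ Metric.ball x₀ ρ → DifferentiableAt ℝ u x →
      δ * ‖fderiv ℝ u x‖ ≤ C₁ - lam * u x := by
    filter_upwards [hsub] with x hx hxB hd
    refine (fderiv ℝ u x).mul_norm_le_of_forall_apply_le hδ fun q hq => ?_
    have h₁ := hx hxB hd q (hq.trans (hδ1.trans (le_max_of_le_left one_le_two)))
    have h₂ := Lag_le_of_mul_norm_sub_le (fun p => hC₁ x p (Metric.mem_ball.1 hxB).le) hq
    linarith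
  have hv : LipschitzOnWith (Real.toNNReal lam * K) (fun x => C₁ - lam * u x)
      (Metric.ball x₀ ρ) := by
    refine LipschitzOnWith.of_dist_le_mul fun x hx y hy => ?_
    have hxy := hu.dist_le_mul x hx y hy
    rw [dist_sub_left, Real.dist_eq, ← mul_sub, abs_mul, abs_of_pos hlam, NNReal.coe_mul,
      Real.coe_toNNReal _ hlam.le, mul_assoc]
    exact mul_le_mul_of_nonneg_left hxy hlam.le
  have hvgrad : ∀ᵐ x : Euc N ∂volume, x ∈ Metric.ball x₀ ρ →
      ‖fderiv ℝ (fun x => C₁ - lam * u x) x‖ ≤ k * (C₁ - lam * u x) := by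
    filter_upwards [hgrad, hu.ae_differentiableWithinAt_of_mem (μ := volume)] with x hx hd hxB
    have hdx := (hd hxB).differentiableAt (Metric.isOpen_ball.mem_nhds hxB)
    have hfd : HasFDerivAt (fun x => C₁ - lam * u x) (-(lam • fderiv ℝ u x)) x :=
      (hdx.hasFDerivAt.const_mul lam).const_sub C₁
    rw [hfd.fderiv, norm_neg, norm_smul, Real.norm_of_nonneg hlam.le, hk, div_mul_eq_mul_div,
      le_div_iff₀ hδ]
    have := mul_le_mul_of_nonneg_left (hx hxB hdx) hlam.le
    linarith
  have hbound : ∀ x ∈ Metric.ball x₀ ρ, C₁ - lam * u x ≤ V := fun x hx => by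
    have hdist : dist x z ≤ 2 * ρ := by
      have := dist_triangle_right x z x₀
      rw [Metric.mem_ball] at hx hz
      linarith
    calc C₁ - lam * u x ≤ Real.exp (k * dist x z) * (C₁ - lam * u z) :=
          hv.le_exp_mul_dist_of_ae_norm_fderiv_le volume Metric.isOpen_ball (convex_ball x₀ ρ)
            hvgrad hx hz
      _ ≤ Real.exp (k * dist x z) * max (C₁ - lam * a) 0 := by
          refine mul_le_mul_of_nonneg_left (le_max_of_le_left ?_) (Real.exp_pos _).le
          have := mul_le_mul_of_nonneg_left hua hlam.le
          linarith
      _ ≤ V := by rw [hV]; gcongr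
  filter_upwards [hsub, hgrad] with x hx hg hxB hd q
  rcases le_total ‖q‖ (max 2 (C₁ + C₂)) with hq | hq
  · exact hx hxB hd q hq
  have hg' := hg hxB hd
  have hnorm : ‖fderiv ℝ u x‖ ≤ P := by
    rw [hP, le_div_iff₀ hδ]
    linarith [hbound x hxB]
  have hq0 : q ≠ 0 := norm_pos_iff.1 (two_pos.trans_le ((le_max_left _ _).trans hq))
  have hlow := mul_norm_sub_le_Lag hA1 hsl (P := P + 1) (by positivity)
    (fun p hp => (abs_le.1 (hC₂ x p (Metric.mem_ball.1 hxB).le hp)).2) hq0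
  have hfq : fderiv ℝ u x q ≤ P * ‖q‖ :=
    ((le_abs_self _).trans ((fderiv ℝ u x).le_opNorm q)).trans (by gcongr)
  have hqC : C₁ + C₂ ≤ ‖q‖ := (le_max_right _ _).trans hq
  have hnn : 0 ≤ δ * ‖fderiv ℝ u x‖ := by positivity
  linarith


end
end

section
/- For every z ∈ ℝ^N there exists λ_z > 0 such that for every λ ∈ (0, λ_z) there is an open ball B containing z with u_λ(z) = sup{u(z) : u : B → ℝ locally Lipschitz with λ u(x) + H(x,Du(x)) ≤ 0 for a.e. x ∈ B}; that is, the maximal subsolution of the discounted equation on all of ℝ^N and the maximal subsolution of the discounted equation on B coincide at z. -/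
open MeasureTheory Set
open scoped RealInnerProductSpace

noncomputable section

open Filter Topology Metric

/-- Rademacher's theorem for locally Lipschitz functions on an open set. -/
theorem LocallyLipschitzOn.ae_differentiableAt {N : ℕ} {s : Set (Euc N)} (hs : IsOpen s)
    {u : Euc N → ℝ} (hu : LocallyLipschitzOn s u) :
    ∀ᵐ x : Euc N ∂volume, x ∈ s → DifferentiableAt ℝ u x := by
  rw [ae_iff]
  refine measure_null_of_locally_null _ fun x hx => ?_
  simp only [Classical.not_imp, mem_ofPred_eq] at hx
  obtain ⟨K, t, ht, hK⟩ := hu hx.1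
  rw [hs.nhdsWithin_eq hx.1] at ht
  obtain ⟨o, hot, ho, hxo⟩ := _root_.mem_nhds_iff.1 ht
  have hdiff := (hK.mono hot).ae_differentiableWithinAt_of_mem (μ := volume)
  refine ⟨{y | ¬ (y ∈ o → DifferentiableWithinAt ℝ u o y)}, ?_, hdiff⟩
  filter_upwards [mem_nhdsWithin_of_mem_nhds (ho.mem_nhds hxo), self_mem_nhdsWithin] with y hyo hy
  exact fun h => hy fun _ => (h hyo).differentiableAt (ho.mem_nhds hyo)

theorem LocallyLipschitzOn.max {α : Type*} [PseudoEMetricSpace α] {s : Set α} {f g : α → ℝ}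
    (hf : LocallyLipschitzOn s f) (hg : LocallyLipschitzOn s g) :
    LocallyLipschitzOn s fun x => max (f x) (g x) :=
  locallyLipschitzOn_iff_restrict.2 (hf.restrict.max hg.restrict)

theorem LocallyLipschitzOn.min {α : Type*} [PseudoEMetricSpace α] {s : Set α} {f g : α → ℝ}
    (hf : LocallyLipschitzOn s f) (hg : LocallyLipschitzOn s g) :
    LocallyLipschitzOn s fun x => min (f x) (g x) :=
  locallyLipschitzOn_iff_restrict.2 (hf.restrict.min hg.restrict)

theorem LipschitzOnWith.congr_eqOn {α : Type*} [PseudoEMetricSpace α] {s : Set α} {f g : α → ℝ}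
    {K : NNReal} (hf : LipschitzOnWith K f s) (hfg : EqOn g f s) : LipschitzOnWith K g s :=
  fun x hx y hy => by
    rw [hfg hx, hfg hy]
    exact hf hx hy

theorem norm_gradient {N : ℕ} (u : Euc N → ℝ) (x : Euc N) :
    ‖gradient u x‖ = ‖fderiv ℝ u x‖ :=
  LinearIsometryEquiv.norm_map _ _

/-- If a differentiable function touches another one from below, the gradients agree. -/
theorem gradient_eq_of_eventually_le {N : ℕ} {f g : Euc N → ℝ} {x : Euc N}
    (hf : DifferentiableAt ℝ f x) (hg : DifferentiableAt ℝ g x)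
    (hle : ∀ᶠ y in 𝓝 x, f y ≤ g y) (heq : f x = g x) : gradient f x = gradient g x := by
  have hmin : IsLocalMin (g - f) x := by
    filter_upwards [hle] with y hy
    simp only [Pi.sub_apply]
    linarith
  have h := hmin.fderiv_eq_zero
  rw [fderiv_sub hg hf, sub_eq_zero] at h
  simp only [gradient, h]

/-- A one-sided slope bound at a point of differentiability bounds the gradient. -/
theorem norm_gradient_le_of_eventually_le {N : ℕ} {f : Euc N → ℝ} {x : Euc N} {ε : ℝ}
    (hε : 0 ≤ ε) (hf : DifferentiableAt ℝ f x)
    (hle : ∀ᶠ y in 𝓝 x, f y ≤ f x + ε * ‖y - x‖) : ‖gradient f x‖ ≤ ε := by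
  have key : ∀ v : Euc N, fderiv ℝ f x v ≤ ε * ‖v‖ := by
    intro v
    have hline : HasDerivAt (fun t : ℝ => f (x + t • v)) (fderiv ℝ f x v) 0 := by
      exact hf.hasFDerivAt.hasLineDerivAt v
    have hslope := hline.tendsto_slope_zero_right
    refine le_of_tendsto hslope ?_
    have hcont : Tendsto (fun t : ℝ => x + t • v) (𝓝[>] 0) (𝓝 x) := by
      have : Continuous fun t : ℝ => x + t • v := by fun_prop
      exact (this.tendsto' 0 x (by simp)).mono_left nhdsWithin_le_nhds
    filter_upwards [hcont.eventually hle, self_mem_nhdsWithin] with t ht ht0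
    have ht0 : 0 < t := ht0
    simp only [zero_add, zero_smul, add_zero, smul_eq_mul, add_sub_cancel_left, norm_smul,
      Real.norm_eq_abs, abs_of_pos ht0] at ht ⊢
    rw [inv_mul_le_iff₀ ht0]
    linarith
  rw [norm_gradient]
  refine ContinuousLinearMap.opNorm_le_bound _ hε fun v => ?_
  rw [Real.norm_eq_abs, abs_le]
  have := key (-v)
  rw [map_neg, norm_neg] at this
  exact ⟨by linarith, key v⟩

/-- An a.e. gradient bound on a ball gives the corresponding Lipschitz bound. -/
theorem sub_le_of_ae_norm_gradient_le {N : ℕ} {r κ : ℝ} {u : Euc N → ℝ}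
    (hu : LocallyLipschitzOn (ball 0 r) u)
    (hκ : ∀ᵐ x : Euc N ∂volume, x ∈ ball 0 r → DifferentiableAt ℝ u x → ‖gradient u x‖ ≤ κ)
    {x y : Euc N} (hx : x ∈ ball 0 r) (hy : y ∈ ball 0 r) : u y - u x ≤ κ * ‖y - x‖ := by
  have hgood : ∀ᵐ w : Euc N ∂volume, w ∈ ball 0 r →
      DifferentiableAt ℝ u w ∧ ‖gradient u w‖ ≤ κ := by
    filter_upwards [hκ, hu.ae_differentiableAt isOpen_ball] with w h1 h2 hw
    exact ⟨h2 hw, h1 hw (h2 hw)⟩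
  obtain ⟨T, hTsub, hTmeas, hTnull⟩ := exists_measurable_superset_of_null (ae_iff.1 hgood)
  have hmeas : MeasurableSet {q : ℝ × Euc N | q.2 + (x + q.1 • (y - x)) ∉ T} := by
    have hcont : Continuous fun q : ℝ × Euc N => q.2 + (x + q.1 • (y - x)) := by fun_prop
    exact (hcont.measurable hTmeas).compl
  have hfub : ∀ᵐ h : Euc N ∂volume, ∀ᵐ t : ℝ ∂volume, h + (x + t • (y - x)) ∉ T := by
    rw [← Measure.ae_ae_comm hmeas]
    refine Eventually.of_forall fun t => ?_
    exact (measurePreserving_add_right volume (x + t • (y - x))).quasiMeasurePreserving.ae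
      (measure_eq_zero_iff_ae_notMem.1 hTnull)
  by_contra! hlt
  have hcx : Tendsto (fun h : Euc N => u (h + x)) (𝓝 0) (𝓝 (u x)) := by
    have h1 : ContinuousAt u x := hu.continuousOn.continuousAt (isOpen_ball.mem_nhds hx)
    have h2 : Continuous fun h : Euc N => h + x := by fun_prop
    exact h1.tendsto.comp (h2.tendsto' 0 x (by simp))
  have hcy : Tendsto (fun h : Euc N => u (h + y)) (𝓝 0) (𝓝 (u y)) := by
    have h1 : ContinuousAt u y := hu.continuousOn.continuousAt (isOpen_ball.mem_nhds hy)
    have h2 : Continuous fun h : Euc N => h + y := by fun_prop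
    exact h1.tendsto.comp (h2.tendsto' 0 y (by simp))
  have hbx : ∀ᶠ h : Euc N in 𝓝 0, h + x ∈ ball 0 r := by
    have h2 : Continuous fun h : Euc N => h + x := by fun_prop
    exact (h2.tendsto' 0 x (by simp)).eventually (isOpen_ball.mem_nhds hx)
  have hby : ∀ᶠ h : Euc N in 𝓝 0, h + y ∈ ball 0 r := by
    have h2 : Continuous fun h : Euc N => h + y := by fun_prop
    exact (h2.tendsto' 0 y (by simp)).eventually (isOpen_ball.mem_nhds hy)
  obtain ⟨h, hline, hfar, hxb, hyb⟩ := (Measure.dense_of_ae hfub).inter_nhds_nonempty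
    (((hcy.sub hcx).eventually_const_lt hlt).and (hbx.and hby))
  have hsegb : ∀ t ∈ Icc (0 : ℝ) 1, h + (x + t • (y - x)) ∈ ball (0 : Euc N) r := by
    intro t ht
    have := (convex_ball (0 : Euc N) r).add_smul_sub_mem hxb hyb ht
    convert this using 1
    rw [add_sub_add_left_eq_sub, add_assoc]
  let γ : ℝ → Euc N := fun t => h + (x + t • (y - x))
  have hγlip : LipschitzWith ‖y - x‖₊ γ := by
    refine LipschitzWith.of_dist_le_mul fun s t => ?_
    rw [dist_add_left, dist_add_left, dist_eq_norm, ← sub_smul, norm_smul, coe_nnnorm, mul_comm,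
      dist_eq_norm]
  obtain ⟨K, hK⟩ := (hu.mono (image_subset_iff.2 hsegb)).exists_lipschitzOnWith_of_compact
    (isCompact_Icc.image hγlip.continuous)
  have hcomp : LipschitzOnWith (K * ‖y - x‖₊) (u ∘ γ) (uIcc 0 1) := by
    rw [uIcc_of_le zero_le_one]
    exact hK.comp hγlip.lipschitzOnWith (mapsTo_image _ _)
  have hftc := hcomp.absolutelyContinuousOnInterval.integral_deriv_eq_sub
  have hbound : ‖∫ t in (0 : ℝ)..1, deriv (u ∘ γ) t‖ ≤ κ * ‖y - x‖ * |1 - 0| := by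
    refine intervalIntegral.norm_integral_le_of_norm_le_const_ae ?_
    filter_upwards [hline] with t ht ht01
    rw [uIoc_of_le zero_le_one] at ht01
    have hnot := notMem_subset hTsub ht
    simp only [mem_ofPred_eq, not_not] at hnot
    obtain ⟨hd, hle⟩ := hnot (hsegb t (Ioc_subset_Icc_self ht01))
    have hγd : HasDerivAt γ (y - x) t := by
      have := (((hasDerivAt_id t).smul_const (y - x)).const_add x).const_add h
      simpa [γ] using this
    rw [(HasFDerivAt.comp_hasDerivAt t (f := γ) hd.hasFDerivAt hγd).deriv]
    rw [norm_gradient] at hle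
    exact ((fderiv ℝ u _).le_opNorm _).trans (mul_le_mul_of_nonneg_right hle (norm_nonneg _))
  rw [hftc] at hbound
  simp only [Function.comp, γ, one_smul, add_sub_cancel, zero_smul, add_zero, sub_zero, abs_one,
    mul_one, Real.norm_eq_abs] at hbound
  exact absurd hfar (not_lt.2 ((le_abs_self _).trans hbound))

/-- A function on a ball can be truncated from below by a constant and from above by a cone of
slope `ε`, and thereby extended to the whole space by the cone. -/
theorem exists_truncation_by_cone {N : ℕ} {u : Euc N → ℝ} {R ρ ε A b : ℝ}
    (hu : LocallyLipschitzOn (ball 0 ρ) u) (hε : 0 < ε) (hA : ∀ x : Euc N, ‖x‖ ≤ R → u x ≤ A)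
    (hbA : b ≤ A) (hρ : A + ε * (R - ρ) < b) :
    ∃ w : Euc N → ℝ, LocallyLipschitz w ∧ (∀ x, ‖x‖ ≤ R → w x = max (u x) b) ∧
      ∀ᵐ x : Euc N ∂volume, DifferentiableAt ℝ w x →
        (x ∈ ball 0 ρ ∧ DifferentiableAt ℝ u x ∧ w x = u x ∧ b ≤ u x ∧
          gradient w x = gradient u x) ∨
        (gradient w x = 0 ∧ w x = b ∧ u x < b) ∨
        (‖gradient w x‖ ≤ ε ∧ w x ≤ A ∧ R ≤ ‖x‖) := by
  classical
  have hRρ : R < ρ := by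
    by_contra! h
    nlinarith
  set c : Euc N → ℝ := fun x => A + ε * (R - ‖x‖) with hc
  have hc_lip : LocallyLipschitz c := by
    have : LipschitzWith ε.toNNReal c := by
      refine LipschitzWith.of_le_add_mul _ fun x y => ?_
      have := norm_sub_norm_le y x
      rw [Real.coe_toNNReal _ hε.le, dist_eq_norm, norm_sub_rev]
      simp only [hc]
      nlinarith
    exact this.locallyLipschitz
  have hc_le : ∀ x y, c y ≤ c x + ε * ‖y - x‖ := by
    intro x y
    have := norm_sub_norm_le x y
    rw [norm_sub_rev] at this
    simp only [hc]
    nlinarith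
  let w : Euc N → ℝ := fun x => if x ∈ ball (0 : Euc N) ρ then min (max (u x) b) (c x) else c x
  have hw_in : ∀ x ∈ ball (0 : Euc N) ρ, w x = min (max (u x) b) (c x) := fun x hx => if_pos hx
  have hw_out : ∀ x ∉ ball (0 : Euc N) ρ, w x = c x := fun x hx => if_neg hx
  have hw_le : ∀ x, w x ≤ c x := by
    intro x
    by_cases hx : x ∈ ball (0 : Euc N) ρ
    · rw [hw_in x hx]
      exact min_le_right _ _
    · exact (hw_out x hx).le
  have hw_inner : ∀ x, ‖x‖ ≤ R → w x = max (u x) b := by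
    intro x hx
    rw [hw_in x (by simpa using hx.trans_lt hRρ)]
    refine min_eq_left (max_le ((hA x hx).trans ?_) (hbA.trans ?_)) <;> simp only [hc] <;> nlinarith
  have hlip_in : LocallyLipschitzOn (ball 0 ρ) fun x => min (max (u x) b) (c x) :=
    (hu.max (LocallyLipschitz.const b).locallyLipschitzOn).min hc_lip.locallyLipschitzOn
  refine ⟨w, ?_, hw_inner, ?_⟩
  · intro x
    by_cases hx : x ∈ ball (0 : Euc N) ρ
    · obtain ⟨K, t, ht, hK⟩ := hlip_in hx
      rw [isOpen_ball.nhdsWithin_eq hx] at ht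
      refine ⟨K, t ∩ ball 0 ρ, inter_mem ht (isOpen_ball.mem_nhds hx), ?_⟩
      exact (hK.mono inter_subset_left).congr_eqOn fun y hy => hw_in y hy.2
    · obtain ⟨K, t, ht, hK⟩ := hc_lip x
      have hcx : c x < b := by
        have : ρ ≤ ‖x‖ := by simpa using hx
        simp only [hc]
        nlinarith
      refine ⟨K, t ∩ {y | c y < b},
        inter_mem ht (hc_lip.continuous.continuousAt.eventually_lt_const hcx), ?_⟩
      refine (hK.mono inter_subset_left).congr_eqOn fun y hy => ?_
      by_cases hyb : y ∈ ball (0 : Euc N) ρ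
      · rw [hw_in y hyb]
        exact min_eq_right (le_max_of_le_right (le_of_lt hy.2))
      · exact hw_out y hyb
  · have hmax : LocallyLipschitzOn (ball 0 ρ) fun x => max (u x) b :=
      hu.max (LocallyLipschitz.const b).locallyLipschitzOn
    filter_upwards [hu.ae_differentiableAt isOpen_ball, hmax.ae_differentiableAt isOpen_ball]
      with x hdu hdmax hdw
    by_cases hwc : w x = c x
    · refine Or.inr (Or.inr ?_)
      by_cases hxR : R ≤ ‖x‖
      · refine ⟨norm_gradient_le_of_eventually_le hε.le hdw (Eventually.of_forall fun y => ?_),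
          ?_, hxR⟩
        · rw [hwc]
          exact (hw_le y).trans (hc_le x y)
        · rw [hwc]
          simp only [hc]
          nlinarith
      · exfalso
        push Not at hxR
        have h1 := hw_inner x hxR.le
        have h2 := max_le (hA x hxR.le) hbA
        rw [← h1, hwc] at h2
        simp only [hc] at h2
        nlinarith
    · have hx : x ∈ ball (0 : Euc N) ρ := by
        by_contra hx
        exact hwc (hw_out x hx)
      have hwx : w x = max (u x) b := by
        rw [hw_in x hx] at hwc ⊢
        exact (min_choice _ _).resolve_right hwc
      have hle : ∀ᶠ y in 𝓝 x, w y ≤ max (u y) b := by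
        filter_upwards [isOpen_ball.mem_nhds hx] with y hy
        rw [hw_in y hy]
        exact min_le_left _ _
      have hgw := gradient_eq_of_eventually_le hdw (hdmax hx) hle hwx
      rcases lt_or_ge (u x) b with hub | hub
      · refine Or.inr (Or.inl ⟨?_, hwx.trans (max_eq_right hub.le), hub⟩)
        have hcont := hu.continuousOn.continuousAt (isOpen_ball.mem_nhds hx)
        have hwb : w x = b := hwx.trans (max_eq_right hub.le)
        have := gradient_eq_of_eventually_le (g := fun _ => b) hdw (differentiableAt_const b)
          (by
            filter_upwards [hle, hcont.eventually_lt_const hub] with y hy hyb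
            exact hy.trans (max_le hyb.le le_rfl)) hwb
        rw [this]
        exact gradient_const x b
      · refine Or.inl ⟨hx, hdu hx, hwx.trans (max_eq_left hub), hub, ?_⟩
        rw [hgw]
        exact (gradient_eq_of_eventually_le (hdu hx) (hdmax hx)
          (Eventually.of_forall fun y => le_max_left _ _) (max_eq_left hub).symm).symm

/-- `u` is an (a.e.) subsolution of the discounted equation in the ball of radius `ρ`. -/
def IsDiscSubsolOnBall {N : ℕ} (H : Euc N × Euc N → ℝ) (lam ρ : ℝ) (u : Euc N → ℝ) : Prop :=
  LocallyLipschitzOn (ball 0 ρ) u ∧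
    ∀ᵐ x : Euc N ∂volume, x ∈ ball 0 ρ → DifferentiableAt ℝ u x →
      lam * u x + H (x, gradient u x) ≤ 0

theorem IsDiscSubsol.isDiscSubsolOnBall {N : ℕ} {H : Euc N × Euc N → ℝ} {lam : ℝ}
    {u : Euc N → ℝ} (hu : IsDiscSubsol H lam u) (ρ : ℝ) : IsDiscSubsolOnBall H lam ρ u :=
  ⟨hu.1.locallyLipschitzOn, hu.2.mono fun _ h _ => h⟩

theorem isDiscSubsol_const {N : ℕ} {H : Euc N × Euc N → ℝ} {lam k : ℝ}
    (hk : ∀ x : Euc N, lam * k + H (x, 0) ≤ 0) : IsDiscSubsol H lam fun _ => k := by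
  refine ⟨LocallyLipschitz.const k, Eventually.of_forall fun x _ => ?_⟩
  rw [gradient_fun_const]
  exact hk x

theorem IsDiscSubsolOnBall.max_const {N : ℕ} {H : Euc N × Euc N → ℝ} {lam ρ k : ℝ}
    {u : Euc N → ℝ} (hu : IsDiscSubsolOnBall H lam ρ u)
    (hk : ∀ x : Euc N, lam * k + H (x, 0) ≤ 0) :
    IsDiscSubsolOnBall H lam ρ fun x => max (u x) k := by
  refine ⟨hu.1.max (LocallyLipschitz.const k).locallyLipschitzOn, ?_⟩
  filter_upwards [hu.2, hu.1.ae_differentiableAt isOpen_ball] with x hsub hdu hx hd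
  rcases le_total (u x) k with h | h
  · have hg := gradient_eq_of_eventually_le (f := fun _ => k) (differentiableAt_const k) hd
      (Eventually.of_forall fun y => le_max_right _ _) (max_eq_right h).symm
    rw [← hg, gradient_fun_const, max_eq_right h]
    exact hk x
  · have hg := gradient_eq_of_eventually_le (hdu hx) hd
      (Eventually.of_forall fun y => le_max_left _ _) (max_eq_left h).symm
    rw [← hg, max_eq_left h]
    exact hsub hx (hdu hx)

/-- Discounted subsolutions on large balls are bounded above near the origin, uniformly in the
discount factor. -/
theorem IsDiscSubsolOnBall.le_of_critical {N : ℕ} {H : Euc N × Euc N → ℝ}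
    {lam ρ m R ε C κ : ℝ} (hlam : 0 < lam) (hm : m < 0) (hR : 0 < R) (hε : 0 < ε) (hκ0 : 0 ≤ κ)
    (hfar : ∀ x : Euc N, R ≤ ‖x‖ → ∀ p : Euc N, ‖p‖ ≤ ε → H (x, p) ≤ m)
    (hC : ∀ x : Euc N, H (x, 0) ≤ C)
    (hκ : ∀ x p : Euc N, ‖x‖ ≤ R + 1 → H (x, p) ≤ C → ‖p‖ ≤ κ)
    (hcrit : ∀ a < 0, ∀ u : Euc N → ℝ, ¬ IsSubsol H a u)
    (hρ1 : R + 1 ≤ ρ) (hρ2 : 4 * κ * R < ε * (ρ - R)) {u : Euc N → ℝ}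
    (hu : IsDiscSubsolOnBall H lam ρ u) {x : Euc N} (hx : ‖x‖ ≤ R) : u x ≤ 2 * κ * R := by
  set k : ℝ := -C / lam with hk
  have hlk : lam * k = -C := by rw [hk]; field_simp
  have hv := hu.max_const (k := k) fun x => by rw [hlk]; linarith [hC x]
  set v : Euc N → ℝ := fun x => max (u x) k with hvdef
  have hsub : ball (0 : Euc N) (R + 1) ⊆ ball 0 ρ := ball_subset_ball hρ1
  have hlip : ∀ y z : Euc N, ‖y‖ ≤ R → ‖z‖ ≤ R → v z - v y ≤ 2 * κ * R := by
    intro y z hy hz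
    have h1 : v z - v y ≤ κ * ‖z - y‖ := by
      refine sub_le_of_ae_norm_gradient_le (r := R + 1) (hv.1.mono hsub) ?_ ?_ ?_
      · filter_upwards [hv.2] with w hw hwb hd
        refine hκ w _ (by simpa using (mem_ball_zero_iff.1 hwb).le) ?_
        have h2 := hw (hsub hwb) hd
        have h3 : lam * k ≤ lam * v w := mul_le_mul_of_nonneg_left (le_max_right _ _) hlam.le
        linarith
      · rw [mem_ball_zero_iff]; linarith
      · rw [mem_ball_zero_iff]; linarith
    have h2 : ‖z - y‖ ≤ 2 * R := (norm_sub_le _ _).trans (by linarith)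
    nlinarith
  by_contra! hlt
  have hvx : 2 * κ * R < v x := hlt.trans_le (le_max_left _ _)
  have hκR : 0 ≤ κ * R := by positivity
  obtain ⟨w, hwlip, -, hw⟩ := exists_truncation_by_cone (A := v x + 2 * κ * R)
    (b := v x - 2 * κ * R) (R := R) hv.1 hε (fun y hy => by linarith [hlip x y hx hy])
    (by linarith) (by linarith)
  refine hcrit (max m (-(lam * (v x - 2 * κ * R)))) ?_ w ⟨hwlip, ?_⟩
  · exact max_lt hm (neg_lt_zero.2 (mul_pos hlam (by linarith)))
  · filter_upwards [hw, hv.2] with y hy hvy hd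
    rcases hy hd with ⟨hyb, hdv, -, hby, hg⟩ | ⟨hg, -, hlt⟩ | ⟨hg, -, hyR⟩
    · refine le_max_of_le_right ?_
      rw [hg]
      have h1 := hvy hyb hdv
      have h2 := mul_le_mul_of_nonneg_left hby hlam.le
      linarith
    · refine le_max_of_le_left (hfar y ?_ _ (by rw [hg]; simpa using hε.le))
      by_contra! hyR
      linarith [hlip y x hyR.le hx]
    · exact le_max_of_le_left (hfar y hyR _ hg)

/-- A strict lower bound of `H` over one fibre lies strictly below all admissible levels. -/
theorem exists_gt_forall_le_of_isSubsol {N : ℕ} {H : Euc N × Euc N → ℝ} (hH : Continuous H)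
    (hcoer : ∀ R : ℝ, 0 < R → ∀ C : ℝ, ∃ r : ℝ, ∀ x p : Euc N,
      ‖x‖ ≤ R → r ≤ ‖p‖ → C ≤ H (x, p))
    {m : ℝ} {x₀ : Euc N} (hx₀ : ∀ p : Euc N, m < H (x₀, p)) :
    ∃ m' > m, ∀ a, (∃ u : Euc N → ℝ, IsSubsol H a u) → m' ≤ a := by
  obtain ⟨r, hr⟩ := hcoer (‖x₀‖ + 1) (by positivity) (m + 1)
  have hcomp : IsCompact (closedBall (0 : Euc N) (max r 0)) := isCompact_closedBall 0 _
  obtain ⟨p₀, -, hp₀⟩ := hcomp.exists_isMinOn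
    (nonempty_closedBall.2 (le_max_right r 0))
    (f := fun p => H (x₀, p)) (by fun_prop)
  obtain ⟨μ, hmμ, hμ⟩ := exists_between (hx₀ p₀)
  refine ⟨min μ (m + 1), lt_min hmμ (by linarith), ?_⟩
  rintro a ⟨u, hulip, hu⟩
  have hev : ∀ᶠ x in 𝓝 x₀, ∀ p ∈ closedBall (0 : Euc N) (max r 0), μ < H (x, p) := by
    refine hcomp.eventually_forall_of_forall_eventually fun p hp => ?_
    exact hH.continuousAt.eventually_const_lt (hμ.trans_le (hp₀ hp))
  have hnear : ∀ᶠ x in 𝓝 x₀, ‖x‖ < ‖x₀‖ + 1 :=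
    continuous_norm.continuousAt.eventually_lt_const (by linarith)
  have hdiff := (hulip.locallyLipschitzOn (s := univ)).ae_differentiableAt isOpen_univ
  obtain ⟨x, hx3, hx1, hx2⟩ := (Measure.dense_of_ae (hu.and hdiff)).inter_nhds_nonempty
    (hev.and hnear)
  refine le_trans ?_ (hx3.1 (hx3.2 (mem_univ x)))
  rcases le_total r ‖gradient u x‖ with h | h
  · exact (min_le_right _ _).trans (hr x _ hx2.le h)
  · refine (min_le_left _ _).trans (hx1 _ ?_).le
    rw [mem_closedBall_zero_iff]
    exact h.trans (le_max_left _ _)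

theorem stmt8 {N : ℕ} (hN : 1 ≤ N) (H : Euc N × Euc N → ℝ)
    (hA1 : Continuous H)
    (hA2conv : ∀ x : Euc N, ConvexOn ℝ Set.univ fun p => H (x, p))
    (hA2coer : ∀ R : ℝ, 0 < R → ∀ C : ℝ, ∃ r : ℝ, ∀ x p : Euc N,
      ‖x‖ ≤ R → r ≤ ‖p‖ → C ≤ H (x, p))
    (hA3 : ∃ ε > (0 : ℝ), ∃ m : ℝ,
      (∃ R : ℝ, ∀ x : Euc N, R ≤ ‖x‖ → ∀ p : Euc N, ‖p‖ ≤ ε → H (x, p) ≤ m) ∧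
      (∃ x₀ : Euc N, ∀ p : Euc N, m < H (x₀, p)))
    (hcrit : sInf {a : ℝ | ∃ u : Euc N → ℝ, IsSubsol H a u} = 0)
    (hsl : ∀ x : Euc N, ∀ C : ℝ, ∃ r : ℝ, ∀ p : Euc N, r ≤ ‖p‖ → C * ‖p‖ ≤ H (x, p))
    (um : ℝ → Euc N → ℝ)
    (hum : ∀ lam : ℝ, 0 < lam → ∀ x : Euc N,
      um lam x = sSup {r : ℝ | ∃ v : Euc N → ℝ, IsDiscSubsol H lam v ∧ v x = r})
 :
    ∀ z : Euc N, ∃ lz : ℝ, 0 < lz ∧ ∀ lam : ℝ, 0 < lam → lam < lz →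
      ∃ x₀ : Euc N, ∃ ρ : ℝ, 0 < ρ ∧ z ∈ Metric.ball x₀ ρ ∧
        um lam z = sSup {r : ℝ | ∃ u : Euc N → ℝ,
          LocallyLipschitzOn (Metric.ball x₀ ρ) u ∧
          (∀ᵐ x : Euc N ∂volume, x ∈ Metric.ball x₀ ρ → DifferentiableAt ℝ u x →
            lam * u x + H (x, gradient u x) ≤ 0) ∧ u z = r} := by
  intro z
  obtain ⟨ε, hε, m, ⟨R₀, hR₀⟩, x₀, hx₀⟩ := hA3
  set R : ℝ := max (max R₀ ‖z‖) 1 with hRdef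
  have hR : 0 < R := lt_of_lt_of_le one_pos (le_max_right _ _)
  have hzR : ‖z‖ ≤ R := (le_max_right _ _).trans (le_max_left _ _)
  have hfar : ∀ x : Euc N, R ≤ ‖x‖ → ∀ p : Euc N, ‖p‖ ≤ ε → H (x, p) ≤ m := fun x hx =>
    hR₀ x (((le_max_left _ _).trans (le_max_left _ _)).trans hx)
  obtain ⟨C, hC0, hC⟩ : ∃ C : ℝ, 0 ≤ C ∧ ∀ x : Euc N, H (x, 0) ≤ C := by
    obtain ⟨C, hC⟩ := (isCompact_closedBall (0 : Euc N) R).bddAbove_image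
      (f := fun x => H (x, 0)) (by fun_prop)
    refine ⟨max (max C m) 0, le_max_right _ _, fun x => le_max_of_le_left ?_⟩
    rcases le_total R ‖x‖ with h | h
    · exact le_max_of_le_right (hfar x h 0 (by simpa using hε.le))
    · exact le_max_of_le_left (hC (mem_image_of_mem _ (mem_closedBall_zero_iff.2 h)))
  obtain ⟨κ, hκ0, hκ⟩ : ∃ κ : ℝ, 0 ≤ κ ∧
      ∀ x p : Euc N, ‖x‖ ≤ R + 1 → H (x, p) ≤ C → ‖p‖ ≤ κ := by
    obtain ⟨r, hr⟩ := hA2coer (R + 1) (by positivity) (C + 1)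
    refine ⟨max r 0, le_max_right _ _, fun x p hx hp => le_max_of_le_left ?_⟩
    by_contra! h
    linarith [hr x p hx h.le]
  obtain ⟨m', hmm', hm'⟩ := exists_gt_forall_le_of_isSubsol hA1 hA2coer hx₀
  have hne : {a : ℝ | ∃ u : Euc N → ℝ, IsSubsol H a u}.Nonempty := by
    refine ⟨C, fun _ => 0, LocallyLipschitz.const 0, Eventually.of_forall fun x _ => ?_⟩
    rw [gradient_fun_const]
    exact hC x
  have hm : m < 0 := hmm'.trans_le (hcrit ▸ le_csInf hne hm')
  have hcrit' : ∀ a < 0, ∀ u : Euc N → ℝ, ¬ IsSubsol H a u := fun a ha u hu =>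
    not_lt.2 (hcrit ▸ csInf_le ⟨m', hm'⟩ ⟨u, hu⟩) ha
  set M : ℝ := 2 * κ * R with hM
  have hM0 : 0 ≤ M := by positivity
  refine ⟨-m / (M + 1), div_pos (neg_pos.2 hm) (by positivity), fun lam hlam hlam_lt => ?_⟩
  have hlamM : lam * M + m ≤ 0 := by
    rw [lt_div_iff₀ (by positivity)] at hlam_lt
    linarith
  set k : ℝ := -C / lam with hk
  have hlk : lam * k = -C := by rw [hk]; field_simp
  have hk0 : k ≤ 0 := by
    rw [hk, neg_div]
    exact neg_nonpos.2 (by positivity)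
  have hkH : ∀ x : Euc N, lam * k + H (x, 0) ≤ 0 := fun x => by rw [hlk]; linarith [hC x]
  set ρ : ℝ := R + 1 + (4 * κ * R + (M - k)) / ε with hρ
  have hερ : ε * (ρ - R) = ε + 4 * κ * R + (M - k) := by rw [hρ]; field_simp; ring
  have hκR : 0 ≤ κ * R := by positivity
  have hρ1 : R + 1 ≤ ρ := by
    have : 0 ≤ (4 * κ * R + (M - k)) / ε := div_nonneg (by linarith) hε.le
    linarith
  have hbound : ∀ u : Euc N → ℝ, IsDiscSubsolOnBall H lam ρ u → ∀ x : Euc N, ‖x‖ ≤ R →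
      u x ≤ M := fun u hu x hx =>
    hu.le_of_critical hlam hm hR hε hκ0 hfar hC hκ hcrit' hρ1 (by linarith) hx
  have hconst := isDiscSubsol_const hkH
  refine ⟨0, ρ, by linarith, by rw [mem_ball_zero_iff]; linarith, ?_⟩
  rw [hum lam hlam z]
  refine le_antisymm (csSup_le ⟨k, _, hconst, rfl⟩ ?_) (csSup_le ?_ ?_)
  · rintro _ ⟨v, hv, rfl⟩
    refine le_csSup ⟨M, ?_⟩ ⟨v, (hv.isDiscSubsolOnBall ρ).1, (hv.isDiscSubsolOnBall ρ).2, rfl⟩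
    rintro _ ⟨u, hu1, hu2, rfl⟩
    exact hbound u ⟨hu1, hu2⟩ z hzR
  · exact ⟨k, _, (hconst.isDiscSubsolOnBall ρ).1, (hconst.isDiscSubsolOnBall ρ).2, rfl⟩
  · rintro _ ⟨u, hu1, hu2, rfl⟩
    obtain ⟨w, hwlip, hwR, hw⟩ := exists_truncation_by_cone (b := k) hu1 hε
      (hbound u ⟨hu1, hu2⟩) (hk0.trans hM0) (by linarith)
    have hwsub : IsDiscSubsol H lam w := by
      refine ⟨hwlip, ?_⟩
      filter_upwards [hw, hu2] with y hy huy hd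
      rcases hy hd with ⟨hyb, hdu, hwu, -, hg⟩ | ⟨hg, hwk, -⟩ | ⟨hg, hwM, hyR⟩
      · rw [hwu, hg]
        exact huy hyb hdu
      · rw [hwk, hg]
        exact hkH y
      · have h1 := hfar y hyR _ hg
        have h2 := mul_le_mul_of_nonneg_left hwM hlam.le
        linarith
    refine ((le_max_left (u z) k).trans (hwR z hzR).ge).trans (le_csSup ⟨M, ?_⟩ ⟨w, hwsub, rfl⟩)
    rintro _ ⟨v, hv, rfl⟩
    exact hbound v (hv.isDiscSubsolOnBall ρ) z hzR

end
end
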